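/- arXiv:math/0510066 — 3 statements merged into one kernel-verified Lean document; each statement's English description precedes it below -/
import Mathlib

section
/- Let ρ₀, c₀, ρ₁, c₁ > 0, α ∈ ℝ, t₀ ∈ ℝ. Let v, σ : ℝ × [t₀, ∞) → ℝ be such that their restrictions to (−∞, α] × [t₀, ∞) and to [α', ∞) × [t₀, ∞) (with one-sided limits v(α∓, t), σ(α∓, t) at x = α) are continuously differentiable and satisfy the elastodynamic system with parameters (ρ₀, c₀) for x < α and (ρ₁, c₁) for x > α. Assume the stress is continuous across the fracture, σ(α⁺, t) = σ(α⁻, t) for all t ≥ t₀, and the initial data vanish on the right side: v(x, t₀) = σ(x, t₀) = 0 for x ≥ α. Then for every t ≥ t₀: σ(α⁺, t) = σ(α⁻, t) = −ρ₁ c₁ v(α⁺, t), and v(α⁻, t) = −(ρ₁ c₁/(ρ₀ c₀)) v(α⁺, t) + 2 J⁰ᴿ(α − c₀ (t − t₀), t₀), where J⁰ᴿ(x, t₀) = ½( v(x, t₀) − σ(x, t₀)/(ρ₀ c₀) ) is the initial right-going Riemann invariant in Ω₀. -/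
/-- Chain rule along a line `s ↦ (x + k * (s - t), s)`, in terms of one-sided partial derivatives. -/
lemma hasDerivWithinAt_along_line {f : ℝ × ℝ → ℝ} {I J K : Set ℝ}
    (hI : UniqueDiffOn ℝ I) (hJ : UniqueDiffOn ℝ J) (hf : DifferentiableOn ℝ f (I ×ˢ J))
    {k x t : ℝ} (hKJ : K ⊆ J) (hKI : ∀ s ∈ K, x + k * (s - t) ∈ I) {s : ℝ} (hs : s ∈ K) :
    HasDerivWithinAt (fun s => f (x + k * (s - t), s))
      (k * derivWithin (fun ξ => f (ξ, s)) I (x + k * (s - t)) +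
        derivWithin (fun τ => f (x + k * (s - t), τ)) J s) K s := by
  set y := x + k * (s - t) with hy
  have hyI : y ∈ I := hKI s hs
  have hsJ : s ∈ J := hKJ hs
  have hL := (hf (y, s) ⟨hyI, hsJ⟩).hasFDerivWithinAt
  set L := fderivWithin ℝ f (I ×ˢ J) (y, s)
  have hx : HasDerivWithinAt (fun ξ => f (ξ, s)) (L (1, 0)) I y :=
    hL.comp_hasDerivWithinAt (f := fun ξ : ℝ => (ξ, s)) y
      ((hasDerivWithinAt_id y I).prodMk (hasDerivWithinAt_const y I s))
      (fun _ h => ⟨h, hsJ⟩)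
  have ht : HasDerivWithinAt (fun τ => f (y, τ)) (L (0, 1)) J s :=
    hL.comp_hasDerivWithinAt (f := fun τ : ℝ => (y, τ)) s
      ((hasDerivWithinAt_const s J y).prodMk (hasDerivWithinAt_id s J))
      (fun _ h => ⟨hyI, h⟩)
  have hline : HasDerivWithinAt (fun s => x + k * (s - t)) k K s := by
    simpa using (((hasDerivWithinAt_id s K).sub_const t).const_mul k).const_add x
  have hpath : HasDerivWithinAt (fun s => f (x + k * (s - t), s)) (L (k, 1)) K s :=
    hL.comp_hasDerivWithinAt (f := fun s : ℝ => (x + k * (s - t), s)) s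
      (hline.prodMk (hasDerivWithinAt_id s K)) (fun r h => ⟨hKI r h, hKJ h⟩)
  rw [hx.derivWithin (hI y hyI), ht.derivWithin (hJ s hsJ)]
  convert hpath using 1
  rw [← smul_eq_mul, ← map_smul, ← map_add]
  simp

/-- The Riemann invariant of the elastodynamic system with wave speed `|k|` is constant along a
characteristic of slope `k` that stays in the spatial domain. -/
lemma riemann_invariant_eq_initial {v σ : ℝ × ℝ → ℝ} {I : Set ℝ} {ρ k x t₀ t : ℝ}
    (hI : UniqueDiffOn ℝ I) (hρ : ρ ≠ 0) (hk : k ≠ 0) (ht : t₀ ≤ t)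
    (hv : DifferentiableOn ℝ v (I ×ˢ Set.Ici t₀)) (hσ : DifferentiableOn ℝ σ (I ×ˢ Set.Ici t₀))
    (heqv : ∀ x ∈ I, ∀ t ∈ Set.Ici t₀,
      derivWithin (fun τ => v (x, τ)) (Set.Ici t₀) t =
        (1 / ρ) * derivWithin (fun ξ => σ (ξ, t)) I x)
    (heqσ : ∀ x ∈ I, ∀ t ∈ Set.Ici t₀,
      derivWithin (fun τ => σ (x, τ)) (Set.Ici t₀) t =
        ρ * k ^ 2 * derivWithin (fun ξ => v (ξ, t)) I x)
    (hchar : ∀ s ∈ Set.Icc t₀ t, x + k * (s - t) ∈ I) :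
    v (x, t) - σ (x, t) / (ρ * k) =
      v (x - k * (t - t₀), t₀) - σ (x - k * (t - t₀), t₀) / (ρ * k) := by
  have hderiv : ∀ s ∈ Set.Icc t₀ t, HasDerivWithinAt
      (fun s => v (x + k * (s - t), s) - σ (x + k * (s - t), s) / (ρ * k)) 0
      (Set.Icc t₀ t) s := by
    intro s hs
    have hJ := uniqueDiffOn_Ici t₀
    refine ((hasDerivWithinAt_along_line hI hJ hv Set.Icc_subset_Ici_self hchar hs).sub
      ((hasDerivWithinAt_along_line hI hJ hσ Set.Icc_subset_Ici_self hchar hs).div_const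
        (ρ * k))).congr_deriv ?_
    rw [heqv _ (hchar s hs) s hs.1, heqσ _ (hchar s hs) s hs.1]
    field_simp
    ring
  have hconst := constant_of_derivWithin_zero
    (fun s hs => (hderiv s hs).differentiableWithinAt)
    (fun s hs => (hderiv s (Set.Ico_subset_Icc_self hs)).derivWithin
      (uniqueDiffOn_Icc (hs.1.trans_lt hs.2) s (Set.Ico_subset_Icc_self hs)))
    t (Set.right_mem_Icc.2 ht)
  have hfoot : x + k * (t₀ - t) = x - k * (t - t₀) := by ring
  simpa [hfoot] using hconst

/-- Limit values at the fracture: with continuous stress across x = α and zero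
    initial data on the right, σ(α±,t) = −ρ₁c₁ v(α⁺,t) and
    v(α⁻,t) = −(ρ₁c₁/(ρ₀c₀)) v(α⁺,t) + 2 J⁰ᴿ(α − c₀(t−t₀), t₀).
    The one-sided fields are represented by (v₀, σ₀) on Ω₀ = (−∞,α] and
    (v₁, σ₁) on Ω₁ = [α,∞). -/
theorem fracture_limit_values (ρ₀ c₀ ρ₁ c₁ α t₀ : ℝ)
    (hρ₀ : 0 < ρ₀) (hc₀ : 0 < c₀) (hρ₁ : 0 < ρ₁) (hc₁ : 0 < c₁)
    (v₀ σ₀ v₁ σ₁ : ℝ × ℝ → ℝ)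
    (hv₀ : ContDiffOn ℝ 1 v₀ (Set.Iic α ×ˢ Set.Ici t₀))
    (hσ₀ : ContDiffOn ℝ 1 σ₀ (Set.Iic α ×ˢ Set.Ici t₀))
    (hv₁ : ContDiffOn ℝ 1 v₁ (Set.Ici α ×ˢ Set.Ici t₀))
    (hσ₁ : ContDiffOn ℝ 1 σ₁ (Set.Ici α ×ˢ Set.Ici t₀))
    (heq0v : ∀ x ∈ Set.Iic α, ∀ t ∈ Set.Ici t₀,
      derivWithin (fun τ => v₀ (x, τ)) (Set.Ici t₀) t =
        (1 / ρ₀) * derivWithin (fun ξ => σ₀ (ξ, t)) (Set.Iic α) x)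
    (heq0σ : ∀ x ∈ Set.Iic α, ∀ t ∈ Set.Ici t₀,
      derivWithin (fun τ => σ₀ (x, τ)) (Set.Ici t₀) t =
        ρ₀ * c₀ ^ 2 * derivWithin (fun ξ => v₀ (ξ, t)) (Set.Iic α) x)
    (heq1v : ∀ x ∈ Set.Ici α, ∀ t ∈ Set.Ici t₀,
      derivWithin (fun τ => v₁ (x, τ)) (Set.Ici t₀) t =
        (1 / ρ₁) * derivWithin (fun ξ => σ₁ (ξ, t)) (Set.Ici α) x)
    (heq1σ : ∀ x ∈ Set.Ici α, ∀ t ∈ Set.Ici t₀,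
      derivWithin (fun τ => σ₁ (x, τ)) (Set.Ici t₀) t =
        ρ₁ * c₁ ^ 2 * derivWithin (fun ξ => v₁ (ξ, t)) (Set.Ici α) x)
    (hcont : ∀ t ∈ Set.Ici t₀, σ₁ (α, t) = σ₀ (α, t))
    (hinit : ∀ x ∈ Set.Ici α, v₁ (x, t₀) = 0 ∧ σ₁ (x, t₀) = 0) :
    ∀ t ∈ Set.Ici t₀,
      σ₁ (α, t) = -(ρ₁ * c₁) * v₁ (α, t) ∧
      σ₀ (α, t) = -(ρ₁ * c₁) * v₁ (α, t) ∧
      v₀ (α, t) = -(ρ₁ * c₁ / (ρ₀ * c₀)) * v₁ (α, t) +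
        2 * ((v₀ (α - c₀ * (t - t₀), t₀) -
              σ₀ (α - c₀ * (t - t₀), t₀) / (ρ₀ * c₀)) / 2) := by
  intro t ht
  have ht' : t₀ ≤ t := ht
  have hright := riemann_invariant_eq_initial (k := -c₁) (x := α) (uniqueDiffOn_Ici α) hρ₁.ne'
    (neg_ne_zero.2 hc₁.ne') ht' (hv₁.differentiableOn one_ne_zero)
    (hσ₁.differentiableOn one_ne_zero) heq1v (by simpa only [neg_sq] using heq1σ)
    (fun s hs => by
      have := mul_nonneg hc₁.le (sub_nonneg.2 hs.2)
      simp only [Set.mem_Ici]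
      linarith)
  have hleft := riemann_invariant_eq_initial (k := c₀) (x := α) (uniqueDiffOn_Iic α) hρ₀.ne'
    hc₀.ne' ht' (hv₀.differentiableOn one_ne_zero)
    (hσ₀.differentiableOn one_ne_zero) heq0v heq0σ
    (fun s hs => by
      have := mul_nonneg hc₀.le (sub_nonneg.2 hs.2)
      simp only [Set.mem_Iic]
      linarith)
  have hfoot : α - -c₁ * (t - t₀) ∈ Set.Ici α := by
    have := mul_nonneg hc₁.le (sub_nonneg.2 ht')
    simp only [Set.mem_Ici]
    linarith
  rw [(hinit _ hfoot).1, (hinit _ hfoot).2] at hright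
  have hσ : σ₁ (α, t) = -(ρ₁ * c₁) * v₁ (α, t) := by
    field_simp at hright
    linarith
  have hσ' : σ₀ (α, t) = -(ρ₁ * c₁) * v₁ (α, t) := (hcont t ht).symm.trans hσ
  refine ⟨hσ, hσ', ?_⟩
  rw [mul_div_cancel₀ _ two_ne_zero, ← hleft, hσ']
  ring
end

section
/- Let ρ₀, c₀, ρ₁, c₁, K, d > 0, t₀ ∈ ℝ, and let g : ℝ → ℝ be continuous and bounded (in particular, continuous with compact support). Then there exists a unique differentiable function y : [t₀, ∞) → ℝ with y(t₀) = 0 satisfying y'(t) = f(y(t), t) for all t ≥ t₀; i.e. the nonlinear ODE governing the fracture has a unique global solution. -/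
open Set

/-- A solution of `y' = v(t, y)` cannot leave `[a, b]` when the vector field points strictly inward
at both endpoints. -/
theorem mem_Icc_of_hasDerivWithinAt_of_inward {v : ℝ → ℝ → ℝ} {a b t₀ T : ℝ} {y : ℝ → ℝ}
    (hva : ∀ t ∈ Ici t₀, 0 < v t a) (hvb : ∀ t ∈ Ici t₀, v t b < 0)
    (hy₀ : y t₀ ∈ Icc a b)
    (hy : ∀ t ∈ Icc t₀ T, HasDerivWithinAt y (v t (y t)) (Icc t₀ T) t) :
    ∀ t ∈ Icc t₀ T, y t ∈ Icc a b := by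
  have hcont : ContinuousOn y (Icc t₀ T) := fun t ht => (hy t ht).continuousWithinAt
  have hright : ∀ t ∈ Ico t₀ T, HasDerivWithinAt y (v t (y t)) (Ici t) t := fun t ht =>
    (hy t (Ico_subset_Icc_self ht)).mono_of_mem_nhdsWithin (Icc_mem_nhdsGE_of_mem ht)
  intro t ht
  constructor
  · refine neg_le_neg_iff.1 (image_le_of_deriv_right_lt_deriv_boundary' (f := fun t => -y t)
      (B := fun _ => -a) (B' := fun _ => 0) hcont.neg (fun t ht => (hright t ht).neg)
      (neg_le_neg hy₀.1) continuousOn_const (fun t _ => hasDerivWithinAt_const ..) ?_ ht)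
    intro t ht h
    rw [neg_inj.1 h]
    exact neg_neg_of_pos (hva t ht.1)
  · refine image_le_of_deriv_right_lt_deriv_boundary' (B := fun _ => b) (B' := fun _ => 0)
      hcont hright hy₀.2 continuousOn_const (fun t _ => hasDerivWithinAt_const ..) ?_ ht
    intro t ht h
    rw [h]
    exact hvb t ht.1

/-- Two solutions of `y' = v(t, y)` with the same initial value in `[a, b]` agree when the vector
field is Lipschitz on `[a, b]` and points strictly inward at both endpoints. -/
theorem eqOn_Icc_of_hasDerivWithinAt_of_inward {v : ℝ → ℝ → ℝ} {a b t₀ T : ℝ} {k : NNReal}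
    {y z : ℝ → ℝ} (hva : ∀ t ∈ Ici t₀, 0 < v t a) (hvb : ∀ t ∈ Ici t₀, v t b < 0)
    (hlip : ∀ t ∈ Ici t₀, LipschitzOnWith k (v t) (Icc a b))
    (hy₀ : y t₀ ∈ Icc a b) (hyz : y t₀ = z t₀)
    (hy : ∀ t ∈ Icc t₀ T, HasDerivWithinAt y (v t (y t)) (Icc t₀ T) t)
    (hz : ∀ t ∈ Icc t₀ T, HasDerivWithinAt z (v t (z t)) (Icc t₀ T) t) :
    EqOn y z (Icc t₀ T) :=
  ODE_solution_unique_of_mem_Icc_right (s := fun _ => Icc a b) (fun t ht => hlip t ht.1)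
    (fun t ht => (hy t ht).continuousWithinAt)
    (fun t ht => (hy t (Ico_subset_Icc_self ht)).mono_of_mem_nhdsWithin (Icc_mem_nhdsGE_of_mem ht))
    (fun t ht => mem_Icc_of_hasDerivWithinAt_of_inward hva hvb hy₀ hy t (Ico_subset_Icc_self ht))
    (fun t ht => (hz t ht).continuousWithinAt)
    (fun t ht => (hz t (Ico_subset_Icc_self ht)).mono_of_mem_nhdsWithin (Icc_mem_nhdsGE_of_mem ht))
    (fun t ht => mem_Icc_of_hasDerivWithinAt_of_inward hva hvb (hyz ▸ hy₀) hz t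
      (Ico_subset_Icc_self ht))
    hyz

/-- Existence on a compact time interval, obtained by applying Picard-Lindelöf to the vector field
truncated outside `[a, b]`. -/
theorem exists_hasDerivWithinAt_Icc_of_inward {v : ℝ → ℝ → ℝ} {a b t₀ T x₀ : ℝ} {k : NNReal}
    (hv : Continuous (Function.uncurry v))
    (hva : ∀ t ∈ Ici t₀, 0 < v t a) (hvb : ∀ t ∈ Ici t₀, v t b < 0)
    (hlip : ∀ t ∈ Ici t₀, LipschitzOnWith k (v t) (Icc a b))
    (hx₀ : x₀ ∈ Icc a b) (hT : t₀ ≤ T) :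
    ∃ y : ℝ → ℝ, y t₀ = x₀ ∧
      ∀ t ∈ Icc t₀ T, HasDerivWithinAt y (v t (y t)) (Icc t₀ T) t := by
  have hab : a ≤ b := hx₀.1.trans hx₀.2
  let w : ℝ → ℝ → ℝ := fun t x => v t (projIcc a b hab x)
  obtain ⟨L, hL⟩ := (isCompact_Icc.prod isCompact_Icc).exists_bound_of_continuousOn
    (s := Icc t₀ T ×ˢ Icc a b) hv.continuousOn
  have hPL : IsPicardLindelof w (⟨t₀, left_mem_Icc.2 hT⟩ : Icc t₀ T) x₀
      (L.toNNReal * (T - t₀).toNNReal) 0 L.toNNReal k := by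
    refine ⟨fun t ht => ?_, fun x _ => ?_, fun t ht x _ => ?_, ?_⟩
    · have h := (hlip t ht.1).to_restrict.comp (LipschitzWith.projIcc hab)
      rw [mul_one] at h
      exact h.lipschitzOnWith
    · exact (hv.comp (Continuous.prodMk_left (projIcc a b hab x : ℝ))).continuousOn
    · exact (hL (t, projIcc a b hab x) ⟨ht, (projIcc a b hab x).2⟩).trans (Real.le_coe_toNNReal L)
    · simp [hT]
  obtain ⟨y, hy₀, hy⟩ := hPL.exists_eq_forall_mem_Icc_hasDerivWithinAt₀
  simp only at hy₀
  have hmem : ∀ t ∈ Icc t₀ T, y t ∈ Icc a b :=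
    mem_Icc_of_hasDerivWithinAt_of_inward (v := w) (by simpa [w] using hva) (by simpa [w] using hvb)
      (hy₀ ▸ hx₀) hy
  refine ⟨y, hy₀, fun t ht => ?_⟩
  simpa [w, projIcc_of_mem hab (hmem t ht)] using hy t ht

/-- Global existence and uniqueness for a scalar ODE whose vector field is Lipschitz on `[a, b]`
and points strictly inward at both endpoints. -/
theorem existsUnique_hasDerivWithinAt_Ici_of_inward {v : ℝ → ℝ → ℝ} {a b t₀ x₀ : ℝ} {k : NNReal}
    (hv : Continuous (Function.uncurry v))
    (hva : ∀ t ∈ Ici t₀, 0 < v t a) (hvb : ∀ t ∈ Ici t₀, v t b < 0)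
    (hlip : ∀ t ∈ Ici t₀, LipschitzOnWith k (v t) (Icc a b)) (hx₀ : x₀ ∈ Icc a b) :
    ∃ y : ℝ → ℝ,
      (y t₀ = x₀ ∧ ∀ t ∈ Ici t₀, HasDerivWithinAt y (v t (y t)) (Ici t₀) t) ∧
      ∀ z : ℝ → ℝ, z t₀ = x₀ →
        (∀ t ∈ Ici t₀, HasDerivWithinAt z (v t (z t)) (Ici t₀) t) →
        ∀ t ∈ Ici t₀, z t = y t := by
  have hex : ∀ T : ℝ, ∃ y : ℝ → ℝ, t₀ ≤ T → y t₀ = x₀ ∧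
      ∀ t ∈ Icc t₀ T, HasDerivWithinAt y (v t (y t)) (Icc t₀ T) t := fun T => by
    by_cases hT : t₀ ≤ T
    · obtain ⟨y, hy⟩ := exists_hasDerivWithinAt_Icc_of_inward hv hva hvb hlip hx₀ hT
      exact ⟨y, fun _ => hy⟩
    · exact ⟨0, fun h => (hT h).elim⟩
  choose Y hY using hex
  have hagree : ∀ s T : ℝ, t₀ ≤ s → s ≤ T → Y s s = Y T s := fun s T hs hsT =>
    eqOn_Icc_of_hasDerivWithinAt_of_inward hva hvb hlip ((hY s hs).1 ▸ hx₀)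
      ((hY s hs).1.trans (hY T (hs.trans hsT)).1.symm) (hY s hs).2
      (fun t ht => ((hY T (hs.trans hsT)).2 t ⟨ht.1, ht.2.trans hsT⟩).mono
        (Icc_subset_Icc_right hsT)) (right_mem_Icc.2 hs)
  have hsol : ∀ t ∈ Ici t₀,
      HasDerivWithinAt (fun t => Y t t) (v t (Y t t)) (Ici t₀) t := fun t ht => by
    have hlt : t < t + 1 := lt_add_one t
    have hle : t₀ ≤ t + 1 := le_trans ht hlt.le
    rw [hagree t (t + 1) ht hlt.le]
    have hnhds : Icc t₀ (t + 1) ∈ nhdsWithin t (Ici t₀) :=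
      Filter.mem_of_superset (inter_mem_nhdsWithin _ (Iic_mem_nhds hlt)) fun _ h => h
    refine (((hY (t + 1) hle).2 t ⟨ht, hlt.le⟩).mono_of_mem_nhdsWithin hnhds).congr_of_eventuallyEq
      ?_ (hagree t (t + 1) ht hlt.le)
    filter_upwards [hnhds] with s hs using hagree s (t + 1) hs.1 hs.2
  refine ⟨fun t => Y t t, ⟨(hY t₀ le_rfl).1, hsol⟩, fun z hz₀ hz t ht => ?_⟩
  exact eqOn_Icc_of_hasDerivWithinAt_of_inward (z := fun t => Y t t) hva hvb hlip (hz₀ ▸ hx₀)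
    (hz₀.trans (hY t₀ le_rfl).1.symm)
    (fun s hs => (hz s hs.1).mono Icc_subset_Ici_self)
    (fun s hs => (hsol s hs.1).mono Icc_subset_Ici_self) (right_mem_Icc.2 ht)

/-- The cubic `x ↦ p (1 + q x)² (γ - s x)` is Lipschitz on `[-M, M]`, uniformly in `|γ| ≤ C`. -/
theorem exists_lipschitzOnWith_cubic (p q s C M : ℝ) :
    ∃ k : NNReal, ∀ γ : ℝ, |γ| ≤ C →
      LipschitzOnWith k (fun x => p * (1 + q * x) ^ 2 * (γ - s * x)) (Icc (-M) M) := by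
  obtain ⟨B, hB⟩ := ((isCompact_Icc (a := -C) (b := C)).prod
    ((isCompact_Icc (a := -M) (b := M)))).exists_bound_of_continuousOn
    (f := fun u : ℝ × ℝ => p * (2 * (1 + q * u.2) * q) * (u.1 - s * u.2)
      + p * (1 + q * u.2) ^ 2 * (-s)) (by fun_prop)
  refine ⟨B.toNNReal, fun γ hγ => (convex_Icc _ _).lipschitzOnWith_of_nnnorm_hasDerivWithin_le
    (f' := fun x => p * (2 * (1 + q * x) * q) * (γ - s * x) + p * (1 + q * x) ^ 2 * (-s))
    (fun x _ => ?_) fun x hx => ?_⟩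
  · have h₁ : HasDerivAt (fun x => 1 + q * x) q x := by
      simpa using ((hasDerivAt_id x).const_mul q).const_add 1
    have h₂ : HasDerivAt (fun x => γ - s * x) (-s) x := by
      simpa using ((hasDerivAt_id x).const_mul s).const_sub γ
    simpa using (((h₁.fun_pow 2).const_mul p).fun_mul h₂).hasDerivWithinAt
  · rw [← NNReal.coe_le_coe]
    exact (hB (γ, x) ⟨abs_le.1 hγ, hx⟩).trans (Real.le_coe_toNNReal B)

/-- Global existence and uniqueness for the nonlinear fracture ODE
    y' = f(y, t), y(t₀) = 0, with f(y,t) =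
    (K/(ρ₁c₁)) (1 + ρ₁c₁ y/(Kd))² (g(t) − (1 + ρ₁c₁/(ρ₀c₀)) y) and g
    continuous and bounded. -/
theorem fracture_ode_global_existence_uniqueness (ρ₀ c₀ ρ₁ c₁ K d t₀ : ℝ)
    (hρ₀ : 0 < ρ₀) (hc₀ : 0 < c₀) (hρ₁ : 0 < ρ₁) (hc₁ : 0 < c₁)
    (hK : 0 < K) (hd : 0 < d)
    (g : ℝ → ℝ) (hg : Continuous g) (hgb : ∃ C : ℝ, ∀ t : ℝ, |g t| ≤ C)
    (f : ℝ → ℝ → ℝ)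
    (hf : ∀ y t : ℝ, f y t =
      K / (ρ₁ * c₁) * (1 + ρ₁ * c₁ * y / (K * d)) ^ 2 *
        (g t - (1 + ρ₁ * c₁ / (ρ₀ * c₀)) * y)) :
    ∃ y : ℝ → ℝ,
      (y t₀ = 0 ∧
        ∀ t ∈ Set.Ici t₀, HasDerivWithinAt y (f (y t) t) (Set.Ici t₀) t) ∧
      ∀ z : ℝ → ℝ, z t₀ = 0 →
        (∀ t ∈ Set.Ici t₀, HasDerivWithinAt z (f (z t) t) (Set.Ici t₀) t) →
        ∀ t ∈ Set.Ici t₀, z t = y t := by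
  obtain ⟨C, hC⟩ := hgb
  obtain ⟨p, hp⟩ : ∃ p, p = K / (ρ₁ * c₁) := ⟨_, rfl⟩
  obtain ⟨q, hq⟩ : ∃ q, q = ρ₁ * c₁ / (K * d) := ⟨_, rfl⟩
  obtain ⟨s, hs⟩ : ∃ s, s = 1 + ρ₁ * c₁ / (ρ₀ * c₀) := ⟨_, rfl⟩
  have hp₀ : 0 < p := hp ▸ by positivity
  have hq₀ : 0 < q := hq ▸ by positivity
  have hs₁ : 1 < s := hs ▸ lt_add_of_pos_right 1 (by positivity)
  have hf' : ∀ y t, f y t = p * (1 + q * y) ^ 2 * (g t - s * y) := fun y t => by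
    rw [hf, hp, hq, hs, mul_div_right_comm]
  have hC₀ : 0 ≤ C := (abs_nonneg _).trans (hC t₀)
  -- The barrier is placed beyond the zero `-1/q` of the quadratic factor.
  obtain ⟨M, hM⟩ : ∃ M, M = C + 1 / q + 1 := ⟨_, rfl⟩
  have hCM : C < M := by have := one_div_pos.2 hq₀; linarith
  have hM₀ : 0 < M := hC₀.trans_lt hCM
  have hCsM : C < s * M := by nlinarith
  have hqM : 1 < q * M := by
    have : q * M = q * C + 1 + q := by rw [hM]; field_simp
    have := mul_nonneg hq₀.le hC₀
    linarith
  obtain ⟨k, hk⟩ := exists_lipschitzOnWith_cubic p q s C M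
  refine existsUnique_hasDerivWithinAt_Ici_of_inward (v := fun t y => f y t) (a := -M) (b := M)
    (k := k) ?_ (fun t _ => ?_) (fun t _ => ?_) (fun t _ => ?_) ⟨by linarith, hM₀.le⟩
  · simp only [hf', Function.uncurry_def]
    fun_prop
  · have := (abs_le.1 (hC t)).1
    have hne : 1 + q * -M ≠ 0 := by linarith
    rw [hf']
    exact mul_pos (by positivity) (by linarith)
  · have := (abs_le.1 (hC t)).2
    rw [hf']
    exact mul_neg_of_pos_of_neg (by positivity) (by linarith)
  · simp only [hf']
    exact hk (g t) (hC t)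
end

section
/- Let ρ₀, c₀, ρ₁, c₁, K, d > 0, t₀ ∈ ℝ, let g : ℝ → ℝ be continuous and bounded, and set M = (sup |g|)/(1 + ρ₁ c₁/(ρ₀ c₀)). Then every differentiable function y : [t₀, T) → ℝ (t₀ < T ≤ ∞) with y(t₀) = 0 and y'(t) = f(y(t), t) for all t satisfies |y(t)| ≤ M for all t ∈ [t₀, T); in particular no solution blows up in finite time. -/
/-- A function that starts at or below the level `M`, and whose derivative is nonpositive wherever
it is at least `M`, never exceeds `M`. -/
theorem le_of_hasDerivWithinAt_nonpos_of_ge {u u' : ℝ → ℝ} {a b M : ℝ} (ha : u a ≤ M)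
    (hu : ∀ t ∈ Set.Icc a b, HasDerivWithinAt u (u' t) (Set.Icc a b) t)
    (hu' : ∀ t ∈ Set.Icc a b, M ≤ u t → u' t ≤ 0) :
    ∀ t ∈ Set.Icc a b, u t ≤ M := by
  intro t ht
  have barrier : ∀ ε > 0, u t ≤ M + ε * (t - a) := by
    intro ε hε
    refine image_le_of_deriv_right_lt_deriv_boundary (f' := u')
      (B := fun s => M + ε * (s - a)) (B' := fun _ => ε)
      (fun s hs => (hu s hs).continuousWithinAt) (fun s hs => ?_)
      (by simpa using ha) (fun s => ?_) (fun s hs h => ?_) ht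
    · exact (hu s (Set.Ico_subset_Icc_self hs)).mono_of_mem_nhdsWithin
        (Icc_mem_nhdsGE_of_mem hs)
    · simpa using (((hasDerivAt_id s).sub_const a).const_mul ε).const_add M
    · refine (hu' s (Set.Ico_subset_Icc_self hs) ?_).trans_lt hε
      rw [h]
      exact le_add_of_nonneg_right (mul_nonneg hε.le (sub_nonneg.2 hs.1))
  have hlim : Filter.Tendsto (fun ε : ℝ => M + ε * (t - a)) (nhdsWithin 0 (Set.Ioi 0))
      (nhds M) := by
    have : Continuous fun ε : ℝ => M + ε * (t - a) := by fun_prop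
    simpa using (this.tendsto 0).mono_left nhdsWithin_le_nhds
  exact ge_of_tendsto hlim (Filter.eventually_of_mem self_mem_nhdsWithin barrier)

/-- A priori bound: every solution of the fracture ODE y' = f(y,t), y(t₀) = 0,
    on [t₀, T) (T finite or infinite) satisfies |y(t)| ≤ M with
    M = (sup |g|)/(1 + ρ₁c₁/(ρ₀c₀)); in particular no finite-time blow-up. -/
theorem fracture_ode_a_priori_bound (ρ₀ c₀ ρ₁ c₁ K d t₀ : ℝ)
    (hρ₀ : 0 < ρ₀) (hc₀ : 0 < c₀) (hρ₁ : 0 < ρ₁) (hc₁ : 0 < c₁)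
    (hK : 0 < K) (hd : 0 < d)
    (g : ℝ → ℝ) (hg : Continuous g) (hgb : ∃ C : ℝ, ∀ t : ℝ, |g t| ≤ C)
    (f : ℝ → ℝ → ℝ)
    (hf : ∀ y t : ℝ, f y t =
      K / (ρ₁ * c₁) * (1 + ρ₁ * c₁ * y / (K * d)) ^ 2 *
        (g t - (1 + ρ₁ * c₁ / (ρ₀ * c₀)) * y))
    (M : ℝ) (hM : M = (⨆ t : ℝ, |g t|) / (1 + ρ₁ * c₁ / (ρ₀ * c₀))) :
    (∀ T : ℝ, t₀ < T → ∀ y : ℝ → ℝ, y t₀ = 0 →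
      (∀ t ∈ Set.Ico t₀ T, HasDerivWithinAt y (f (y t) t) (Set.Ico t₀ T) t) →
      ∀ t ∈ Set.Ico t₀ T, |y t| ≤ M) ∧
    (∀ y : ℝ → ℝ, y t₀ = 0 →
      (∀ t ∈ Set.Ici t₀, HasDerivWithinAt y (f (y t) t) (Set.Ici t₀) t) →
      ∀ t ∈ Set.Ici t₀, |y t| ≤ M) := by
  have hA : 0 < 1 + ρ₁ * c₁ / (ρ₀ * c₀) := by positivity
  have hκ : 0 < K / (ρ₁ * c₁) := by positivity
  generalize 1 + ρ₁ * c₁ / (ρ₀ * c₀) = A at hf hM hA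
  have hgM : ∀ t, |g t| ≤ A * M := by
    obtain ⟨C, hC⟩ := hgb
    intro t
    rw [hM, mul_div_cancel₀ _ hA.ne']
    exact le_ciSup (f := fun t => |g t|) ⟨C, Set.forall_mem_range.2 hC⟩ t
  have hM0 : 0 ≤ M := nonneg_of_mul_nonneg_right ((abs_nonneg _).trans (hgM 0)) hA
  have hf_nonpos : ∀ y t, M ≤ y → f y t ≤ 0 := by
    intro y t hy
    rw [hf]
    refine mul_nonpos_of_nonneg_of_nonpos (by positivity) ?_
    have := mul_le_mul_of_nonneg_left hy hA.le
    linarith [(abs_le.1 (hgM t)).2]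
  have hf_nonneg : ∀ y t, M ≤ -y → 0 ≤ f y t := by
    intro y t hy
    rw [hf]
    refine mul_nonneg (by positivity) ?_
    have := mul_le_mul_of_nonneg_left hy hA.le
    linarith [(abs_le.1 (hgM t)).1]
  have bound : ∀ (y : ℝ → ℝ) (t : ℝ), t₀ ≤ t → y t₀ = 0 →
      (∀ s ∈ Set.Icc t₀ t, HasDerivWithinAt y (f (y s) s) (Set.Icc t₀ t) s) → |y t| ≤ M := by
    intro y t ht hy₀ hy
    have upper := le_of_hasDerivWithinAt_nonpos_of_ge (hy₀.trans_le hM0) hy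
      (fun s _ => hf_nonpos (y s) s) t (Set.right_mem_Icc.2 ht)
    have lower := le_of_hasDerivWithinAt_nonpos_of_ge (u := fun s => -y s) (M := M)
      (by simpa [hy₀] using hM0) (fun s hs => (hy s hs).fun_neg)
      (fun s _ h => neg_nonpos.2 (hf_nonneg (y s) s h)) t (Set.right_mem_Icc.2 ht)
    exact abs_le.2 ⟨neg_le.1 lower, upper⟩
  refine ⟨fun T _ y hy₀ hy t ht => bound y t ht.1 hy₀ fun s hs => ?_,
    fun y hy₀ hy t ht => bound y t ht hy₀ fun s hs => ?_⟩
  · exact (hy s ⟨hs.1, hs.2.trans_lt ht.2⟩).mono (Set.Icc_subset_Ico_right ht.2)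
  · exact (hy s hs.1).mono Set.Icc_subset_Ici_self
end
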